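/- Let L/E be a quadratic field extension in characteristic ≠ 2 with nontrivial Galois automorphism ι, and write L = E(√δ). The trace form map h ↦ q_h identifies the Witt group W(L, ι) of hermitian forms over (L, ι) with the kernel of the base-change map W(E) → W(L); the image of W(L, ι) → W(E) is the principal ideal of W(E) generated by the binary form ⟨1, −δ⟩. Moreover, for a ∈ E*, the trace form of the rank-1 hermitian form ⟨a⟩ is isomorphic to a·⟨1, −δ⟩. -/

import Mathlib

section Defs

variable (F : Type*) [Field F]

/-- Isometry of two "quadratic forms", given as plain value functions. -/
def QFunEquiv {V₁ V₂ : Type*} [AddCommGroup V₁] [Module F V₁]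
    [AddCommGroup V₂] [Module F V₂] (q₁ : V₁ → F) (q₂ : V₂ → F) : Prop :=
  ∃ g : V₁ ≃ₗ[F] V₂, ∀ x, q₂ (g x) = q₁ x

/-- The diagonal quadratic form `⟨c i⟩ᵢ`. -/
def diagQ {ι : Type*} [Fintype ι] (c : ι → F) : (ι → F) → F :=
  fun x => ∑ i, c i * x i ^ 2

/-- Diagonal coefficients `⟨1, -1, …⟩` of a sum of `k` hyperbolic planes. -/
def hypDiag (k : ℕ) : Fin (2 * k) → F :=
  fun j => if (j : ℕ) % 2 = 0 then 1 else -1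

/-- Orthogonal sum of two quadratic forms. -/
def qSum {V₁ V₂ : Type*} (q₁ : V₁ → F) (q₂ : V₂ → F) : V₁ × V₂ → F :=
  fun p => q₁ p.1 + q₂ p.2

/-- Witt equivalence: isometry after adding hyperbolic planes. -/
def WittEquivQ {V₁ V₂ : Type*} [AddCommGroup V₁] [Module F V₁]
    [AddCommGroup V₂] [Module F V₂] (q₁ : V₁ → F) (q₂ : V₂ → F) : Prop :=
  ∃ k m : ℕ, QFunEquiv F (qSum F q₁ (diagQ F (hypDiag F k)))
    (qSum F q₂ (diagQ F (hypDiag F m)))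

end Defs

section Herm

variable (E L : Type*) [Field E] [Field L] [Algebra E L] (σ : L ≃ₐ[E] L)

/-- The diagonal hermitian form `⟨λᵢ⟩ᵢ` (with `λᵢ ∈ E*`) over `(L, ι)`, where
`ι` is the nontrivial automorphism of the quadratic extension `L/E`. -/
def hermL {ι' : Type*} [Fintype ι'] (lam : ι' → E) (x y : ι' → L) : L :=
  ∑ i, σ (x i) * algebraMap E L (lam i) * y i

/-- Isometry of diagonal hermitian forms over `(L, ι)`: an `E`-linear equivalence
which is `L`-linear and matches the forms. -/
def HermIsoL {ι₁ ι₂ : Type*} [Fintype ι₁] [Fintype ι₂]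
    (lam : ι₁ → E) (mu : ι₂ → E) : Prop :=
  ∃ g : (ι₁ → L) ≃ₗ[E] (ι₂ → L),
    (∀ (x : ι₁ → L) (d : L), g (fun i => x i * d) = fun i => g x i * d) ∧
    (∀ x y, hermL E L σ mu (g x) (g y) = hermL E L σ lam x y)

/-- Witt equivalence of diagonal hermitian forms over `(L, ι)` (hyperbolic
planes are `⟨1, -1⟩`). -/
def HermWittEquivL {ι₁ ι₂ : Type*} [Fintype ι₁] [Fintype ι₂]
    (lam : ι₁ → E) (mu : ι₂ → E) : Prop :=
  ∃ k m : ℕ, HermIsoL E L σ (Sum.elim lam (hypDiag E k)) (Sum.elim mu (hypDiag E m))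

end Herm

section Coeffs

/-- The multiset of values of a finite family. -/
def coeffs {ι F : Type*} [Fintype ι] (c : ι → F) : Multiset F :=
  Finset.univ.val.map c

variable {ι κ F : Type*} [Fintype ι] [Fintype κ]

theorem card_coeffs (c : ι → F) : (coeffs c).card = Fintype.card ι := by
  simp [coeffs]

theorem mem_coeffs {c : ι → F} {a : F} : a ∈ coeffs c ↔ ∃ i, c i = a := by
  simp [coeffs]

theorem coeffs_map {K : Type*} (φ : F → K) (c : ι → F) :
    (coeffs c).map φ = coeffs fun i => φ (c i) := by
  simp [coeffs]

theorem coeffs_sumElim (c : ι → F) (d : κ → F) :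
    coeffs (Sum.elim c d) = coeffs c + coeffs d := by
  simp [coeffs, ← Finset.univ_disjSum_univ, Finset.val_disjSum, Multiset.disjSum]

theorem coeffs_fin_succ {n : ℕ} (c : Fin (n + 1) → F) :
    coeffs c = c 0 ::ₘ coeffs (fun i : Fin n => c i.succ) := by
  simp [coeffs, List.ofFn_succ]

theorem coeffs_fin_zero (c : Fin 0 → F) : coeffs c = 0 := by
  simp [coeffs]

theorem coeffs_fin_one (c : Fin 1 → F) : coeffs c = {c 0} := by
  simp [coeffs]

theorem coeffs_fin_two (c : Fin 2 → F) : coeffs c = {c 0, c 1} := by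
  rw [coeffs_fin_succ, coeffs_fin_one]; rfl

theorem exists_coeffs_eq (S : Multiset F) : ∃ c : Fin S.card → F, coeffs c = S := by
  induction S using Quotient.inductionOn with
  | _ l => exact ⟨l.get, (Fin.univ_val_map l.get).trans (congrArg _ (List.ofFn_get l))⟩

/-- A family with prescribed multiset of values. -/
noncomputable def ofCoeffs (S : Multiset F) : Fin S.card → F :=
  (exists_coeffs_eq S).choose

theorem coeffs_ofCoeffs (S : Multiset F) : coeffs (ofCoeffs S) = S :=
  (exists_coeffs_eq S).choose_spec

theorem exists_equiv_of_coeffs_eq {c : ι → F} {d : κ → F} (h : coeffs c = coeffs d) :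
    ∃ e : ι ≃ κ, ∀ i, d (e i) = c i := by
  classical
  have key : ∀ y, Nonempty ({i // c i = y} ≃ {j // d j = y}) := by
    intro y
    refine ⟨Fintype.equivOfCardEq ?_⟩
    have := congrArg (Multiset.count y) h
    simp only [coeffs, Multiset.count_map] at this
    rw [Fintype.card_subtype, Fintype.card_subtype]
    simpa [Finset.card, Finset.filter_val, eq_comm] using this
  have e := fun y => (key y).some
  refine ⟨(Equiv.sigmaFiberEquiv c).symm.trans
    ((Equiv.sigmaCongrRight e).trans (Equiv.sigmaFiberEquiv d)), fun i => ?_⟩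
  exact ((e (c i)) ⟨i, rfl⟩).2

theorem coeffs_hypDiag (F : Type*) [Field F] (k : ℕ) :
    coeffs (hypDiag F k) = k • ({1, -1} : Multiset F) := by
  induction k with
  | zero => simp [coeffs]
  | succ k ih =>
    have h : coeffs (hypDiag F (k + 1)) = coeffs (hypDiag F k) + {1, -1} := by
      change ((Finset.univ.val.map (hypDiag F (k + 1) : Fin (2 * k + 1 + 1) → F)) : Multiset F) = _
      rw [Fin.univ_val_map, List.ofFn_succ', List.ofFn_succ', coeffs, Fin.univ_val_map]
      simp only [List.concat_eq_append, List.append_assoc, ← Multiset.coe_add]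
      congr 1
      simp [hypDiag]
    rw [h, ih, add_smul, one_smul]

end Coeffs

section HermCon

variable {E L : Type*} [Field E] [Field L] [Algebra E L] {σ : L ≃ₐ[E] L}
variable {ι κ ι' κ' : Type*} [Fintype ι] [Fintype κ] [Fintype ι'] [Fintype κ']

theorem HermIsoL.of_linearEquiv {c : ι → E} {d : κ → E} (g : (ι → L) ≃ₗ[L] (κ → L))
    (hg : ∀ x y, hermL E L σ d (g x) (g y) = hermL E L σ c x y) : HermIsoL E L σ c d := by
  refine ⟨g.restrictScalars E, fun x a => ?_, hg⟩
  have : (fun i => x i * a) = a • x := by ext i; simp [mul_comm]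
  ext j
  simp only [this]
  simp [mul_comm]

theorem HermIsoL.exists_linearEquiv {c : ι → E} {d : κ → E} (h : HermIsoL E L σ c d) :
    ∃ g : (ι → L) ≃ₗ[L] (κ → L),
      ∀ x y, hermL E L σ d (g x) (g y) = hermL E L σ c x y := by
  obtain ⟨g, hl, hg⟩ := h
  refine ⟨{ g with map_smul' := fun a x => ?_ }, hg⟩
  have := hl x a
  have h2 : (fun i => x i * a) = a • x := by ext i; simp [mul_comm]
  rw [h2] at this
  ext j
  simpa [mul_comm] using congrFun this j

theorem HermIsoL.symm {c : ι → E} {d : κ → E} (h : HermIsoL E L σ c d) :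
    HermIsoL E L σ d c := by
  obtain ⟨g, hg⟩ := h.exists_linearEquiv
  exact .of_linearEquiv g.symm fun x y => by rw [← hg]; simp

theorem HermIsoL.trans {c : ι → E} {d : κ → E} {e : ι' → E} (h : HermIsoL E L σ c d)
    (h' : HermIsoL E L σ d e) : HermIsoL E L σ c e := by
  obtain ⟨g, hg⟩ := h.exists_linearEquiv
  obtain ⟨g', hg'⟩ := h'.exists_linearEquiv
  exact .of_linearEquiv (g.trans g') fun x y => by simp [hg, hg']

theorem hermL_sumElim (c : ι → E) (d : κ → E) (x y : ι ⊕ κ → L) :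
    hermL E L σ (Sum.elim c d) x y =
      hermL E L σ c (x ∘ Sum.inl) (y ∘ Sum.inl) + hermL E L σ d (x ∘ Sum.inr) (y ∘ Sum.inr) := by
  simp [hermL]

theorem HermIsoL.sumElim {c : ι → E} {d : κ → E} {c' : ι' → E} {d' : κ' → E}
    (h : HermIsoL E L σ c c') (h' : HermIsoL E L σ d d') :
    HermIsoL E L σ (Sum.elim c d) (Sum.elim c' d') := by
  obtain ⟨g, hg⟩ := h.exists_linearEquiv
  obtain ⟨g', hg'⟩ := h'.exists_linearEquiv
  refine .of_linearEquiv ((LinearEquiv.sumArrowLequivProdArrow ι κ L L).trans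
    ((g.prodCongr g').trans (LinearEquiv.sumArrowLequivProdArrow ι' κ' L L).symm)) fun x y => ?_
  simp only [hermL_sumElim, ← hg, ← hg']
  rfl

theorem HermIsoL.of_equiv {c : ι → E} {d : κ → E} (e : ι ≃ κ) (h : ∀ i, d (e i) = c i) :
    HermIsoL E L σ c d :=
  .of_linearEquiv (LinearEquiv.funCongrLeft L L e.symm) fun x y => by
    simp only [hermL, ← h]
    rw [← e.sum_comp]
    simp [LinearEquiv.funCongrLeft_apply, LinearMap.funLeft_apply]

theorem HermIsoL.of_coeffs_eq {c : ι → E} {d : κ → E} (h : coeffs c = coeffs d) :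
    HermIsoL E L σ c d :=
  let ⟨e, he⟩ := exists_equiv_of_coeffs_eq h
  .of_equiv e he

variable (E L σ) in
/-- Isometry of diagonal hermitian forms, as an additive congruence on the multisets of their
coefficients. -/
def hermCon : AddCon (Multiset E) where
  r S T := HermIsoL E L σ (ofCoeffs S) (ofCoeffs T)
  iseqv := ⟨fun _ => .of_coeffs_eq rfl, HermIsoL.symm, HermIsoL.trans⟩
  add' h h' := (HermIsoL.of_coeffs_eq (by simp [coeffs_sumElim, coeffs_ofCoeffs])).trans
    ((h.sumElim h').trans (.of_coeffs_eq (by simp [coeffs_sumElim, coeffs_ofCoeffs])))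

variable (E L σ) in
/-- The isometry class of the diagonal hermitian form with coefficients `S`. -/
def hermCls (S : Multiset E) : (hermCon E L σ).Quotient := S

theorem hermCls_add (S T : Multiset E) :
    hermCls E L σ (S + T) = hermCls E L σ S + hermCls E L σ T := rfl

theorem hermCls_zero : hermCls E L σ 0 = 0 := rfl

theorem hermCls_nsmul (k : ℕ) (S : Multiset E) :
    hermCls E L σ (k • S) = k • hermCls E L σ S := rfl

theorem hermCls_cons (a : E) (S : Multiset E) :
    hermCls E L σ (a ::ₘ S) = hermCls E L σ {a} + hermCls E L σ S := rfl

theorem hermCls_coeffs_eq_iff {c : ι → E} {d : κ → E} :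
    hermCls E L σ (coeffs c) = hermCls E L σ (coeffs d) ↔ HermIsoL E L σ c d := by
  refine (AddCon.eq _).trans ⟨fun h => ?_, fun h => ?_⟩
  · exact (HermIsoL.of_coeffs_eq (coeffs_ofCoeffs _).symm).trans
      (HermIsoL.trans h (.of_coeffs_eq (coeffs_ofCoeffs _)))
  · exact (HermIsoL.of_coeffs_eq (coeffs_ofCoeffs _)).trans
      (HermIsoL.trans h (.of_coeffs_eq (coeffs_ofCoeffs _).symm))

theorem hermWittEquivL_iff {c : ι → E} {d : κ → E} :
    HermWittEquivL E L σ c d ↔ ∃ k m : ℕ,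
      hermCls E L σ (coeffs c) + k • hermCls E L σ {1, -1} =
        hermCls E L σ (coeffs d) + m • hermCls E L σ {1, -1} := by
  simp only [HermWittEquivL, ← hermCls_coeffs_eq_iff, coeffs_sumElim, coeffs_hypDiag,
    hermCls_add, hermCls_nsmul]

theorem hermCls_mul_norm {a b : E} {x : L} (hb : b ≠ 0)
    (h : σ x * algebraMap E L a * x = algebraMap E L b) :
    hermCls E L σ {b} = hermCls E L σ {a} := by
  have hx : x ≠ 0 := by
    rintro rfl
    exact hb (by simpa using h.symm)
  have := (hermCls_coeffs_eq_iff (σ := σ) (c := fun _ : Fin 1 => b) (d := fun _ : Fin 1 => a)).2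
    (.of_linearEquiv (LinearEquiv.smulOfNeZero L (Fin 1 → L) x hx) fun u v => by
      simp [hermL, ← h]; ring)
  simpa [coeffs_fin_one] using this

theorem hermCls_pair_neg (h2 : (2 : E) ≠ 0) {a : E} (ha : a ≠ 0) :
    hermCls E L σ {a, -a} = hermCls E L σ {1, -1} := by
  have h2' : (2 : L) ≠ 0 := by
    simpa only [map_ofNat] using (map_ne_zero (algebraMap E L)).2 h2
  have ha' : algebraMap E L a ≠ 0 := (map_ne_zero (algebraMap E L)).2 ha
  have := (hermCls_coeffs_eq_iff (σ := σ) (c := ![a, -a]) (d := ![1, -1])).2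
    (.of_linearEquiv
      { toFun := fun x => ![((algebraMap E L a + 1) * x 0 + (algebraMap E L a - 1) * x 1) / 2,
          ((algebraMap E L a - 1) * x 0 + (algebraMap E L a + 1) * x 1) / 2]
        invFun := fun y => ![((algebraMap E L a + 1) * y 0 - (algebraMap E L a - 1) * y 1) /
            (2 * algebraMap E L a),
          ((algebraMap E L a + 1) * y 1 - (algebraMap E L a - 1) * y 0) / (2 * algebraMap E L a)]
        map_add' := fun x y => by ext i; fin_cases i <;> simp <;> ring
        map_smul' := fun t x => by ext i; fin_cases i <;> simp <;> ring
        left_inv := fun x => by ext i; fin_cases i <;> simp <;> field_simp <;> ring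
        right_inv := fun x => by ext i; fin_cases i <;> simp <;> field_simp <;> ring }
      fun x y => by
        simp [hermL, map_div₀, map_ofNat σ 2]
        field_simp
        ring)
  simpa [coeffs_fin_two] using this

theorem hermCls_pair_eq (hσ : ∀ x, σ (σ x) = x) {a b c : E} {x : L} (ha : a ≠ 0)
    (h : algebraMap E L a = σ x * algebraMap E L c * x + algebraMap E L b) :
    hermCls E L σ {c, b} = hermCls E L σ {a, a * (c * b)} := by
  have ha' : algebraMap E L a ≠ 0 := (map_ne_zero (algebraMap E L)).2 ha
  have hb : algebraMap E L b = algebraMap E L a - σ x * algebraMap E L c * x := by rw [h]; ring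
  have := (hermCls_coeffs_eq_iff (σ := σ) (c := ![a, a * (c * b)]) (d := ![c, b])).2
    (.of_linearEquiv
      { toFun := fun u => ![x * u 0 - algebraMap E L b * u 1, u 0 + algebraMap E L c * σ x * u 1]
        invFun := fun p => ![(algebraMap E L c * σ x * p 0 + algebraMap E L b * p 1) /
          algebraMap E L a, (x * p 1 - p 0) / algebraMap E L a]
        map_add' := fun x y => by ext i; fin_cases i <;> simp <;> ring
        map_smul' := fun t x => by ext i; fin_cases i <;> simp <;> ring
        left_inv := fun x => by ext i; fin_cases i <;> simp [hb] <;> field_simp <;> ring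
        right_inv := fun x => by ext i; fin_cases i <;> simp [hb] <;> field_simp <;> ring }
      fun x y => by
        simp [hermL, hσ, h]
        ring)
  simpa [coeffs_fin_two] using this.symm

theorem exists_hermCls_eq_cons (hσ : ∀ x, σ (σ x) = x)
    (hN : ∀ x, ∃ n : E, algebraMap E L n = σ x * x) :
    ∀ {n : ℕ} (c : Fin n → E), (∀ i, c i ≠ 0) → ∀ (x : Fin n → L) (b : E), b ≠ 0 →
      algebraMap E L b = hermL E L σ c x x →
      ∃ T : Multiset E, 0 ∉ T ∧ T.card + 1 = n ∧
        hermCls E L σ (coeffs c) = hermCls E L σ (b ::ₘ T) := by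
  intro n
  induction n with
  | zero => intro c _ x b hb h; simp [hermL, hb] at h
  | succ n ih =>
    intro c hc x b hb h
    obtain ⟨m, hm⟩ := hN (x 0)
    rw [hermL, Fin.sum_univ_succ] at h
    have htail : algebraMap E L (b - c 0 * m) =
        hermL E L σ (fun i : Fin n => c i.succ) (fun i => x i.succ) (fun i => x i.succ) := by
      simp only [map_sub, map_mul, hm, h, hermL]
      ring
    by_cases hb' : b - c 0 * m = 0
    · refine ⟨coeffs fun i : Fin n => c i.succ, ?_, by simp [card_coeffs], ?_⟩
      · rw [mem_coeffs]
        rintro ⟨i, hi⟩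
        exact hc _ hi
      · rw [coeffs_fin_succ, hermCls_cons, hermCls_cons b, hermCls_mul_norm (x := x 0) hb]
        rw [sub_eq_zero.1 hb', map_mul, hm]
        ring
    · obtain ⟨T, hT0, hTc, hT⟩ := ih (fun i : Fin n => c i.succ) (fun i => hc _) _ _ hb' htail
      refine ⟨(b * (c 0 * (b - c 0 * m))) ::ₘ T, ?_, by simp [hTc], ?_⟩
      · simp [hT0, hb, hc 0, eq_comm (a := (0 : E)), hb']
      · have := hermCls_pair_eq (σ := σ) hσ (a := b) (b := b - c 0 * m) (c := c 0) (x := x 0) hb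
          (by simp [hm]; ring)
        rw [coeffs_fin_succ, hermCls_cons, hT, hermCls_cons (b - c 0 * m), ← add_assoc]
        change hermCls E L σ {c 0, _} + _ = _
        rw [this, ← hermCls_add]
        simp [Multiset.insert_eq_cons]

theorem exists_hermCls_eq_hyperbolic_add (h2 : (2 : E) ≠ 0) (hσ : ∀ x, σ (σ x) = x)
    (hN : ∀ x, ∃ n : E, algebraMap E L n = σ x * x) :
    ∀ {n : ℕ} (c : Fin n → E), (∀ i, c i ≠ 0) → ∀ x : Fin n → L, x ≠ 0 →
      hermL E L σ c x x = 0 →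
      ∃ T : Multiset E, 0 ∉ T ∧ T.card + 2 = n ∧
        hermCls E L σ (coeffs c) = hermCls E L σ {1, -1} + hermCls E L σ T := by
  intro n
  induction n with
  | zero => intro c _ x hx; exact absurd (Subsingleton.elim _ _) hx
  | succ n ih =>
    intro c hc x hx h
    rw [hermL, Fin.sum_univ_succ] at h
    by_cases hx0 : x 0 = 0
    · obtain ⟨T, hT0, hTc, hT⟩ := ih (fun i : Fin n => c i.succ) (fun i => hc _) (fun i => x i.succ)
        (fun h0 => hx (by
          ext i
          exact Fin.cases hx0 (fun i => congrFun h0 i) i)) (by simpa [hx0, hermL] using h)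
      refine ⟨c 0 ::ₘ T, by simp [hT0, (hc 0).symm], by simp [← hTc], ?_⟩
      rw [coeffs_fin_succ, hermCls_cons, hT, hermCls_cons (c 0) T]
      abel
    · obtain ⟨m, hm⟩ := hN (x 0)
      have hm0 : m ≠ 0 := by
        rintro rfl
        simp [hx0] at hm
      have hb : c 0 * m ≠ 0 := mul_ne_zero (hc 0) hm0
      obtain ⟨T, hT0, hTc, hT⟩ := exists_hermCls_eq_cons hσ hN (fun i => c i.succ)
        (fun i => hc _) (fun i => x i.succ) (-(c 0 * m)) (neg_ne_zero.2 hb) (by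
          rw [map_neg, map_mul, hm, hermL, neg_eq_iff_add_eq_zero, ← h]
          ring)
      refine ⟨T, hT0, by simp [← hTc], ?_⟩
      rw [coeffs_fin_succ, hermCls_cons, hT, hermCls_cons (-(c 0 * m)), ← add_assoc,
        ← hermCls_mul_norm (σ := σ) (a := c 0) (x := x 0) hb (by rw [map_mul, hm]; ring),
        ← hermCls_pair_neg (σ := σ) h2 hb]
      rfl

end HermCon

section Quad

variable {F : Type*} [Field F]
variable {V V₁ V₂ V₁' V₂' : Type*} [AddCommGroup V] [Module F V] [AddCommGroup V₁] [Module F V₁]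
  [AddCommGroup V₂] [Module F V₂] [AddCommGroup V₁'] [Module F V₁'] [AddCommGroup V₂'] [Module F V₂']
variable {ι κ : Type*} [Fintype ι] [Fintype κ]

theorem QFunEquiv.refl (q : V → F) : QFunEquiv F q q := ⟨.refl F V, fun _ => rfl⟩

theorem QFunEquiv.symm {q₁ : V₁ → F} {q₂ : V₂ → F} (h : QFunEquiv F q₁ q₂) :
    QFunEquiv F q₂ q₁ := by
  obtain ⟨g, hg⟩ := h
  exact ⟨g.symm, fun x => by simp [← hg]⟩

theorem QFunEquiv.trans {q₁ : V₁ → F} {q₂ : V₂ → F} {q : V → F} (h : QFunEquiv F q₁ q₂)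
    (h' : QFunEquiv F q₂ q) : QFunEquiv F q₁ q := by
  obtain ⟨g, hg⟩ := h
  obtain ⟨g', hg'⟩ := h'
  exact ⟨g.trans g', fun x => by simp [hg, hg']⟩

theorem QFunEquiv.qSum {q₁ : V₁ → F} {q₂ : V₂ → F} {q₁' : V₁' → F} {q₂' : V₂' → F}
    (h₁ : QFunEquiv F q₁ q₁') (h₂ : QFunEquiv F q₂ q₂') :
    QFunEquiv F (qSum F q₁ q₂) (qSum F q₁' q₂') := by
  obtain ⟨g, hg⟩ := h₁
  obtain ⟨g', hg'⟩ := h₂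
  exact ⟨g.prodCongr g', fun x => by simp [_root_.qSum, hg, hg']⟩

theorem WittEquivQ.congr {q₁ : V₁ → F} {q₂ : V₂ → F} {q₁' : V₁' → F} {q₂' : V₂' → F}
    (h : WittEquivQ F q₁ q₂) (h₁ : QFunEquiv F q₁ q₁') (h₂ : QFunEquiv F q₂ q₂') :
    WittEquivQ F q₁' q₂' := by
  obtain ⟨k, m, h⟩ := h
  exact ⟨k, m, (h₁.symm.qSum (.refl _)).trans (h.trans (h₂.qSum (.refl _)))⟩

theorem qSum_diagQ (c : ι → F) (d : κ → F) :
    QFunEquiv F (qSum F (diagQ F c) (diagQ F d)) (diagQ F (Sum.elim c d)) :=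
  ⟨(LinearEquiv.sumArrowLequivProdArrow ι κ F F).symm, fun x => by
    simp [diagQ, qSum, LinearEquiv.sumArrowLequivProdArrow, Equiv.sumArrowEquivProdArrow]⟩

theorem hermL_refl_self (c : ι → F) (x : ι → F) :
    hermL F F AlgEquiv.refl c x x = diagQ F c x := by
  simp only [hermL, diagQ, AlgEquiv.coe_refl, id]
  exact Finset.sum_congr rfl fun i _ => by simp; ring

theorem diagQ_add (c : ι → F) (x y : ι → F) :
    diagQ F c (x + y) = diagQ F c x + diagQ F c y + 2 * hermL F F AlgEquiv.refl c x y := by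
  simp only [hermL, diagQ, AlgEquiv.coe_refl, id, Finset.mul_sum, ← Finset.sum_add_distrib]
  exact Finset.sum_congr rfl fun i _ => by simp; ring

theorem qFunEquiv_diagQ_iff (h2 : (2 : F) ≠ 0) {c : ι → F} {d : κ → F} :
    QFunEquiv F (diagQ F c) (diagQ F d) ↔ HermIsoL F F AlgEquiv.refl c d := by
  constructor
  · rintro ⟨g, hg⟩
    refine .of_linearEquiv g fun x y => mul_left_cancel₀ h2 ?_
    have := hg (x + y)
    rw [map_add, diagQ_add, diagQ_add, hg, hg] at this
    exact add_left_cancel this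
  · intro h
    obtain ⟨g, hg⟩ := h.exists_linearEquiv
    exact ⟨g, fun x => by simpa only [hermL_refl_self] using hg x x⟩

variable (F) in
/-- The isometry class of the diagonal quadratic form with coefficients `S`. -/
abbrev quadCls (S : Multiset F) : (hermCon F F AlgEquiv.refl).Quotient :=
  hermCls F F AlgEquiv.refl S

theorem quadCls_add (S T : Multiset F) : quadCls F (S + T) = quadCls F S + quadCls F T := rfl

theorem quadCls_zero : quadCls F 0 = 0 := rfl

theorem quadCls_nsmul (k : ℕ) (S : Multiset F) : quadCls F (k • S) = k • quadCls F S := rfl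

theorem quadCls_eq_iff (h2 : (2 : F) ≠ 0) {c : ι → F} {d : κ → F} :
    quadCls F (coeffs c) = quadCls F (coeffs d) ↔ QFunEquiv F (diagQ F c) (diagQ F d) :=
  hermCls_coeffs_eq_iff.trans (qFunEquiv_diagQ_iff h2).symm

theorem wittEquivQ_diagQ_iff (h2 : (2 : F) ≠ 0) {c : ι → F} {d : κ → F} :
    WittEquivQ F (diagQ F c) (diagQ F d) ↔ ∃ k m : ℕ,
      quadCls F (coeffs c) + k • quadCls F {1, -1} =
        quadCls F (coeffs d) + m • quadCls F {1, -1} := by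
  refine Iff.trans ?_ hermWittEquivL_iff
  refine exists_congr fun k => exists_congr fun m => ?_
  rw [← qFunEquiv_diagQ_iff h2]
  exact ⟨fun h => (qSum_diagQ _ _).symm.trans (h.trans (qSum_diagQ _ _)),
    fun h => (qSum_diagQ _ _).trans (h.trans (qSum_diagQ _ _).symm)⟩

variable (F) in
/-- A function `q` on `V` is metabolic if it vanishes on a subspace of at least half the
dimension. -/
def IsMetabolic (q : V → F) : Prop :=
  ∃ W : Submodule F V, (∀ w ∈ W, q w = 0) ∧ Module.finrank F V ≤ 2 * Module.finrank F W

theorem IsMetabolic.congr {q₁ : V₁ → F} {q₂ : V₂ → F} (h : IsMetabolic F q₁)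
    (e : QFunEquiv F q₁ q₂) : IsMetabolic F q₂ := by
  obtain ⟨W, hW, hd⟩ := h
  obtain ⟨g, hg⟩ := e
  refine ⟨W.map (g : V₁ →ₗ[F] V₂), ?_, ?_⟩
  · rintro _ ⟨w, hw, rfl⟩
    exact (hg w).trans (hW w hw)
  · rwa [← g.finrank_eq, LinearEquiv.finrank_map_eq]

theorem IsMetabolic.exists_ne_zero [FiniteDimensional F V] {q : V → F} (h : IsMetabolic F q)
    (hV : 0 < Module.finrank F V) : ∃ x ≠ 0, q x = 0 := by
  obtain ⟨W, hW, hd⟩ := h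
  have : W ≠ ⊥ := by
    rintro rfl
    simp at hd
    omega
  obtain ⟨x, hx, hx0⟩ := W.exists_mem_ne_zero_of_ne_bot this
  exact ⟨x, hx0, hW x hx⟩

theorem diagQ_plane (p : Fin 2 → F) : diagQ F ![1, -1] p = p 0 ^ 2 - p 1 ^ 2 := by
  simp [diagQ]
  ring

theorem IsMetabolic.qSum_plane [FiniteDimensional F V] {q : V → F} (h : IsMetabolic F q) :
    IsMetabolic F (qSum F q (diagQ F ![1, -1])) := by
  obtain ⟨W, hW, hd⟩ := h
  let f : (W × F) →ₗ[F] V × (Fin 2 → F) :=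
    W.subtype.prodMap (LinearMap.toSpanSingleton F _ ![1, 1])
  have hf : Function.Injective f := by
    rintro ⟨w, a⟩ ⟨w', b⟩ h
    have h1 : w = w' := Subtype.ext (congrArg Prod.fst h)
    have h3 : a = b := by simpa [f] using congrFun (congrArg Prod.snd h) 0
    rw [h1, h3]
  refine ⟨LinearMap.range f, ?_, ?_⟩
  · rintro _ ⟨⟨w, t⟩, rfl⟩
    simp [f, qSum, hW w w.2, diagQ_plane]
  · rw [LinearMap.finrank_range_of_inj hf, Module.finrank_prod, Module.finrank_prod,
      Module.finrank_fin_fun, Module.finrank_self]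
    omega

theorem IsMetabolic.of_qSum_plane [FiniteDimensional F V] (h2 : (2 : F) ≠ 0) {q : V → F}
    (h : IsMetabolic F (qSum F q (diagQ F ![1, -1]))) : IsMetabolic F q := by
  obtain ⟨W, hW, hd⟩ := h
  have hq : ∀ v (p : Fin 2 → F), (v, p) ∈ W → p 0 = p 1 → q v = 0 := fun v p hp h01 => by
    simpa [qSum, diagQ_plane, h01] using hW _ hp
  rw [Module.finrank_prod, Module.finrank_fin_fun] at hd
  let pr : W →ₗ[F] V := (LinearMap.fst F V (Fin 2 → F)).domRestrict W
  let ℓ : W →ₗ[F] F := ((LinearMap.proj (R := F) (φ := fun _ : Fin 2 => F) 0 -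
    LinearMap.proj (R := F) (φ := fun _ : Fin 2 => F) 1) ∘ₗ
    LinearMap.snd F V (Fin 2 → F)).domRestrict W
  have hℓ : ∀ w : W, ℓ w = w.1.2 0 - w.1.2 1 := fun w => rfl
  by_cases he : ((0 : V), (![1, 1] : Fin 2 → F)) ∈ W
  · have hiso : ∀ w : W, w.1.2 0 = w.1.2 1 := by
      rintro ⟨⟨v, p⟩, hw⟩
      have h1 := hW _ hw
      have h3 := hW _ (W.add_mem hw he)
      simp only [qSum, diagQ_plane, Prod.mk_add_mk, add_zero, Pi.add_apply] at h1 h3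
      simp at h3
      refine mul_left_cancel₀ h2 ?_
      linear_combination h3 - h1
    refine ⟨LinearMap.range pr, ?_, ?_⟩
    · rintro _ ⟨w, rfl⟩
      exact hq _ _ w.2 (hiso w)
    · have hk : Module.finrank F (LinearMap.ker pr) ≤ 1 := by
        rw [← Module.finrank_self F]
        refine LinearMap.finrank_le_finrank_of_injective
          (f := (LinearMap.proj (0 : Fin 2) ∘ₗ LinearMap.snd F V (Fin 2 → F) ∘ₗ
            W.subtype ∘ₗ (LinearMap.ker pr).subtype)) ?_
        refine (injective_iff_map_eq_zero _).2 ?_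
        rintro ⟨w, hw⟩ h0
        have h0 : w.1.2 0 = 0 := h0
        have hw : w.1.1 = 0 := hw
        ext
        · exact hw
        · rename_i i
          fin_cases i
          · exact h0
          · exact (hiso w).symm.trans h0
      have := pr.finrank_range_add_finrank_ker
      omega
  · refine ⟨LinearMap.range (pr ∘ₗ (LinearMap.ker ℓ).subtype), ?_, ?_⟩
    · rintro _ ⟨w, rfl⟩
      exact hq _ _ w.1.2 (sub_eq_zero.1 ((hℓ w).symm.trans w.2))
    · have hinj : Function.Injective (pr ∘ₗ (LinearMap.ker ℓ).subtype) := by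
        refine (injective_iff_map_eq_zero _).2 ?_
        rintro ⟨⟨⟨v, p⟩, hw⟩, hl⟩ h0
        have h0 : v = 0 := h0
        have h01 : p 0 - p 1 = 0 := hl
        obtain ⟨t, rfl⟩ : ∃ t : F, p = t • ![1, 1] := by
          refine ⟨p 0, ?_⟩
          ext i
          fin_cases i
          · simp
          · simpa using (sub_eq_zero.1 h01).symm
        subst h0
        have ht : t = 0 := by
          by_contra ht
          refine he ?_
          have := W.smul_mem t⁻¹ hw
          rwa [Prod.smul_mk, smul_zero, smul_smul, inv_mul_cancel₀ ht, one_smul] at this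
        subst ht
        ext
        · rfl
        · simp
      rw [LinearMap.finrank_range_of_inj hinj]
      have h3 := ℓ.finrank_range_add_finrank_ker
      have h4 := (LinearMap.range ℓ).finrank_le
      rw [Module.finrank_self] at h4
      omega

theorem isMetabolic_congr_cls (h2 : (2 : F) ≠ 0) {c : ι → F} {d : κ → F}
    (h : quadCls F (coeffs c) = quadCls F (coeffs d)) (hc : IsMetabolic F (diagQ F c)) :
    IsMetabolic F (diagQ F d) :=
  hc.congr ((quadCls_eq_iff h2).1 h)

theorem isMetabolic_hyperbolic (h2 : (2 : F) ≠ 0) (m : ℕ) :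
    IsMetabolic F (diagQ F (ofCoeffs (m • ({1, -1} : Multiset F)))) := by
  induction m with
  | zero => exact ⟨⊥, by simp [diagQ], by simp⟩
  | succ m ih =>
    refine isMetabolic_congr_cls h2 ?_ (ih.qSum_plane.congr (qSum_diagQ _ _))
    rw [coeffs_sumElim, coeffs_ofCoeffs, coeffs_ofCoeffs, coeffs_fin_two, succ_nsmul]
    rfl

theorem isMetabolic_of_cls (h2 : (2 : F) ≠ 0) {c : ι → F} {k m : ℕ}
    (h : quadCls F (coeffs c) + k • quadCls F {1, -1} = m • quadCls F {1, -1}) :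
    IsMetabolic F (diagQ F c) := by
  have key : ∀ (k : ℕ) (S : Multiset F),
      IsMetabolic F (diagQ F (ofCoeffs (S + k • ({1, -1} : Multiset F)))) →
      IsMetabolic F (diagQ F (ofCoeffs S)) := by
    intro k
    induction k with
    | zero => intro S hS; rwa [zero_nsmul, add_zero] at hS
    | succ k ih =>
      intro S hS
      refine ih S (.of_qSum_plane h2 (.congr ?_ (qSum_diagQ _ _).symm))
      refine isMetabolic_congr_cls h2 ?_ hS
      rw [coeffs_sumElim, coeffs_ofCoeffs, coeffs_ofCoeffs, coeffs_fin_two, succ_nsmul, ← add_assoc]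
      rfl
  refine isMetabolic_congr_cls h2 (congrArg _ (coeffs_ofCoeffs _)) (key k _ ?_)
  refine isMetabolic_congr_cls h2 ?_ (isMetabolic_hyperbolic h2 m)
  rw [coeffs_ofCoeffs, coeffs_ofCoeffs]
  exact h.symm

end Quad

section Split

open Matrix

variable {F : Type*} [Field F] {ι κ : Type*} [Fintype ι] [Fintype κ]

theorem exists_quadCls_eq_pair_add (h2 : (2 : F) ≠ 0) {c : ι → F} (hc : ∀ i, c i ≠ 0)
    {u w : ι → F} (hu : diagQ F c u ≠ 0) (hw : diagQ F c w ≠ 0)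
    (huw : hermL F F AlgEquiv.refl c u w = 0) :
    ∃ T : Multiset F, 0 ∉ T ∧ T.card + 2 = Fintype.card ι ∧
      quadCls F (coeffs c) = quadCls F {diagQ F c u, diagQ F c w} + quadCls F T := by
  classical
  have : Invertible (2 : F) := invertibleOfNonzero h2
  let Q : QuadraticForm F (ι → F) := QuadraticMap.weightedSumSquares F c
  have hQ : ∀ x, Q x = diagQ F c x := fun x => by
    simp [Q, QuadraticMap.weightedSumSquares_apply, diagQ, pow_two]
  let B : LinearMap.BilinForm F (ι → F) := QuadraticMap.associated Q
  have hBQ : ∀ x, B x x = Q x := fun x => QuadraticMap.associated_eq_self_apply F Q x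
  have hB : ∀ x y, B x y = hermL F F AlgEquiv.refl c x y := fun x y => by
    refine mul_left_cancel₀ h2 ?_
    have h1 : Q (x + y) = Q x + Q y + 2 * B x y := by
      rw [← hBQ, ← hBQ x, ← hBQ y, map_add, map_add, LinearMap.add_apply, LinearMap.add_apply,
        two_mul]
      have : B y x = B x y := QuadraticMap.associated_isSymm F Q y x
      rw [this]
      ring
    rw [hQ, hQ, hQ, diagQ_add] at h1
    exact (add_left_cancel h1).symm
  have hsymm : ∀ x y, B x y = B y x := fun x y => by
    rw [hB, hB]
    simp only [hermL, AlgEquiv.coe_refl, id]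
    exact Finset.sum_congr rfl fun i _ => by ring
  have hBu : B u u ≠ 0 := by rwa [hBQ, hQ]
  have hBw : B w w ≠ 0 := by rwa [hBQ, hQ]
  have hBuw : B u w = 0 := by rwa [hB]
  have hBwu : B w u = 0 := by rwa [hsymm]
  let U : Submodule F (ι → F) := LinearMap.ker (B u) ⊓ LinearMap.ker (B w)
  have hUu : ∀ x : U, B u x = 0 := fun x => x.2.1
  have hUw : ∀ x : U, B w x = 0 := fun x => x.2.2
  let f : ((Fin 2 → F) × U) →ₗ[F] (ι → F) :=
    { toFun := fun p => p.1 0 • u + p.1 1 • w + p.2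
      map_add' := fun p p' => by
        simp only [Prod.fst_add, Prod.snd_add, Pi.add_apply, Submodule.coe_add]; module
      map_smul' := fun t p => by
        simp only [Prod.smul_fst, Prod.smul_snd, Pi.smul_apply, Submodule.coe_smul, smul_eq_mul,
          RingHom.id_apply]
        module }
  have hf : ∀ p, f p = p.1 0 • u + p.1 1 • w + p.2 := fun p => rfl
  have hfu : ∀ p, B u (f p) = p.1 0 * B u u := fun p => by simp [hf, hBuw, hUu]
  have hfw : ∀ p, B w (f p) = p.1 1 * B w w := fun p => by simp [hf, hBwu, hUw]
  have hinj : Function.Injective f := by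
    refine (injective_iff_map_eq_zero _).2 fun p hp => ?_
    have h0 : p.1 0 = 0 := by simpa [hp, hBu] using hfu p
    have h1 : p.1 1 = 0 := by simpa [hp, hBw] using hfw p
    have h3 : (p.2 : ι → F) = 0 := by simpa [hf, h0, h1] using hp
    refine Prod.ext ?_ (Subtype.ext h3)
    ext i
    fin_cases i
    · exact h0
    · exact h1
  have hsurj : Function.Surjective f := fun v => by
    refine ⟨(![B u v / B u u, B w v / B w w],
      ⟨v - (B u v / B u u) • u - (B w v / B w w) • w, ?_, ?_⟩), ?_⟩
    · simp [hBuw, hBu]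
    · simp [hBwu, hBw]
    · simp [hf]
  let e := LinearEquiv.ofBijective f ⟨hinj, hsurj⟩
  let Q' : QuadraticForm F U := Q.comp U.subtype
  have hB' : ∀ x y : U, QuadraticMap.associated Q' x y = B x y := fun x y => by
    simp [Q', B, QuadraticMap.associated_comp]
  obtain ⟨d, ⟨g⟩⟩ := Q'.equivalent_weightedSumSquares_units_of_nondegenerate' (by
    intro x hx
    have hx0 : ∀ v, B x v = 0 := fun v => by
      obtain ⟨p, rfl⟩ := hsurj v
      have h1 : B x p.2 = 0 := (hB' _ _).symm.trans (hx p.2)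
      have h3 : B x u = 0 := by rw [hsymm, hUu]
      have h4 : B x w = 0 := by rw [hsymm, hUw]
      simp [hf, h1, h3, h4]
    ext i
    have := hx0 (Pi.single i 1)
    rw [hB] at this
    simpa [hermL, Pi.single_apply, hc i] using this)
  have hcard : Module.finrank F U + 2 = Fintype.card ι := by
    have := e.finrank_eq
    rw [Module.finrank_prod, Module.finrank_fin_fun, Module.finrank_fintype_fun_eq_card] at this
    omega
  refine ⟨coeffs fun i => (d i : F), ?_, by simpa [card_coeffs] using hcard, ?_⟩
  · rw [mem_coeffs]
    rintro ⟨i, hi⟩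
    exact (d i).ne_zero hi
  · have key : QFunEquiv F (diagQ F c)
        (diagQ F (Sum.elim ![diagQ F c u, diagQ F c w] fun i => (d i : F))) := by
      have h₁ : QFunEquiv F (qSum F (diagQ F ![diagQ F c u, diagQ F c w]) Q') (diagQ F c) := by
        refine ⟨e, fun p => ?_⟩
        change diagQ F c (f p) = _
        have h1 : B (p.2 : ι → F) u = 0 := by rw [hsymm, hUu]
        have h3 : B (p.2 : ι → F) w = 0 := by rw [hsymm, hUw]
        have h4 : Q' p.2 = B p.2 p.2 := (hBQ _).symm
        rw [← hQ, ← hBQ, hf, qSum, ← hQ u, ← hQ w, ← hBQ u, ← hBQ w, h4]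
        simp [hBuw, hBwu, hUu, hUw, h1, h3, diagQ]
        ring
      have h₂ : QFunEquiv F Q' (diagQ F fun i => (d i : F)) := by
        refine ⟨g.toLinearEquiv, fun x => ?_⟩
        have := g.map_app x
        rw [QuadraticMap.weightedSumSquares_apply] at this
        rw [← this]
        simp [diagQ, pow_two, Units.smul_def]
      exact h₁.symm.trans ((QFunEquiv.qSum (.refl _) h₂).trans (qSum_diagQ _ _))
    have := (quadCls_eq_iff h2).2 key
    rwa [coeffs_sumElim, coeffs_fin_two] at this

theorem hermL_refl_eq_dotProduct [DecidableEq ι] (c x y : ι → F) :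
    hermL F F AlgEquiv.refl c x y = x ⬝ᵥ (diagonal c *ᵥ y) := by
  simp [hermL, dotProduct, mulVec_diagonal, mul_assoc]

theorem mulVec_dotProduct_mulVec (M : Matrix κ ι F) (D : Matrix κ κ F) (x y : ι → F) :
    (M *ᵥ x) ⬝ᵥ (D *ᵥ (M *ᵥ y)) = x ⬝ᵥ ((Mᵀ * D * M) *ᵥ y) := by
  rw [← vecMul_transpose, ← dotProduct_mulVec, mulVec_mulVec, mulVec_mulVec, Matrix.mul_assoc]

theorem HermIsoL.map_refl {K : Type*} [Field K] (φ : F →+* K) {c : ι → F} {d : κ → F}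
    (h : HermIsoL F F AlgEquiv.refl c d) :
    HermIsoL K K AlgEquiv.refl (fun i => φ (c i)) (fun j => φ (d j)) := by
  classical
  obtain ⟨g, hg⟩ := h.exists_linearEquiv
  let M := LinearMap.toMatrix' (g : (ι → F) →ₗ[F] (κ → F))
  let N := LinearMap.toMatrix' (g.symm : (κ → F) →ₗ[F] (ι → F))
  have hMN : M * N = 1 := by
    rw [← LinearMap.toMatrix'_comp]
    simp
  have hNM : N * M = 1 := by
    rw [← LinearMap.toMatrix'_comp]
    simp
  have hM : ∀ x, g x = M *ᵥ x := fun x => by simp [M, LinearMap.toMatrix'_mulVec]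
  have hD : Mᵀ * diagonal d * M = diagonal c := by
    ext i j
    have := hg (Pi.single i 1) (Pi.single j 1)
    rw [hermL_refl_eq_dotProduct, hermL_refl_eq_dotProduct, hM, hM, mulVec_dotProduct_mulVec] at this
    by_cases hij : i = j
    · subst hij
      simpa using this
    · simpa [hij, Ne.symm hij] using this
  have hD' : (M.map φ)ᵀ * diagonal (fun j => φ (d j)) * M.map φ = diagonal (fun i => φ (c i)) := by
    have := congrArg (fun X : Matrix ι ι F => X.map φ) hD
    simpa [Matrix.map_mul, transpose_map, diagonal_map] using this
  refine .of_linearEquiv (Matrix.toLin'OfInv (M := N.map φ) (M' := M.map φ) ?_ ?_) fun x y => ?_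
  · rw [← Matrix.map_mul, hNM]; simp
  · rw [← Matrix.map_mul, hMN]; simp
  · rw [hermL_refl_eq_dotProduct, hermL_refl_eq_dotProduct, ← hD']
    exact mulVec_dotProduct_mulVec _ _ _ _

theorem quadCls_map {K : Type*} [Field K] (φ : F →+* K) {S T : Multiset F}
    (h : quadCls F S = quadCls F T) : quadCls K (S.map φ) = quadCls K (T.map φ) := by
  rw [← coeffs_ofCoeffs S, ← coeffs_ofCoeffs T] at h ⊢
  rw [coeffs_map, coeffs_map]
  exact hermCls_coeffs_eq_iff.2 ((hermCls_coeffs_eq_iff.1 h).map_refl φ)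

end Split

section Trace

variable {E L : Type*} [Field E] [Field L] [Algebra E L] {σ : L ≃ₐ[E] L} {δ : E}
variable {ι κ : Type*} [Fintype ι] [Fintype κ]

/-- The coefficients of `⟨1, -δ⟩ ⊗ S`. -/
def traceCoeffs (δ : E) (S : Multiset E) : Multiset E :=
  S + S.map fun a => -δ * a

theorem traceCoeffs_zero : traceCoeffs δ (0 : Multiset E) = 0 := by
  simp [traceCoeffs]

theorem traceCoeffs_add (S T : Multiset E) :
    traceCoeffs δ (S + T) = traceCoeffs δ S + traceCoeffs δ T := by
  simp only [traceCoeffs, Multiset.map_add]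
  abel

theorem traceCoeffs_singleton (a : E) : traceCoeffs δ {a} = {a, -δ * a} := rfl

theorem traceCoeffs_nsmul (k : ℕ) (S : Multiset E) :
    traceCoeffs δ (k • S) = k • traceCoeffs δ S := by
  simp [traceCoeffs, Multiset.map_nsmul]

theorem coeffs_sumElim_trace (c : ι → E) :
    coeffs (Sum.elim c fun i => -δ * c i) = traceCoeffs δ (coeffs c) := by
  rw [coeffs_sumElim, traceCoeffs, coeffs_map]

theorem coeffs_prod_trace {t : ℕ} (d : Fin t → E) :
    coeffs (fun p : Fin t × Fin 2 => d p.1 * (if p.2 = 0 then 1 else -δ)) =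
      traceCoeffs δ (coeffs d) := by
  rw [← coeffs_sumElim_trace]
  let f : Fin t ⊕ Fin t ≃ Fin t × Fin 2 :=
    ((Equiv.boolProdEquivSum (Fin t)).symm.trans (Equiv.prodComm _ _)).trans
      (Equiv.prodCongr (.refl _) finTwoEquiv.symm)
  rw [coeffs, ← Multiset.map_univ_val_equiv f, Multiset.map_map]
  refine Multiset.map_congr rfl fun i _ => ?_
  rcases i with i | i
  · change d i * (if (0 : Fin 2) = 0 then 1 else -δ) = d i
    simp
  · change d i * (if (1 : Fin 2) = 0 then 1 else -δ) = -δ * d i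
    simp [mul_comm]

variable {e : L ≃ₗ[E] E × E}

theorem exists_linearEquiv_trace
    (he : ∀ x, σ x * x = algebraMap E L ((e x).1 ^ 2 - δ * (e x).2 ^ 2)) :
    ∃ g : (ι → L) ≃ₗ[E] (ι ⊕ ι → E), ∀ (c : ι → E) (x : ι → L),
      hermL E L σ c x x = algebraMap E L (diagQ E (Sum.elim c fun i => -δ * c i) (g x)) := by
  refine ⟨
    { toFun := fun x => Sum.elim (fun i => (e (x i)).1) fun i => (e (x i)).2
      invFun := fun y i => e.symm (y (.inl i), y (.inr i))
      map_add' := fun x y => by ext (i | i) <;> simp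
      map_smul' := fun a x => by ext (i | i) <;> simp
      left_inv := fun x => by ext i; simp
      right_inv := fun y => by ext (i | i) <;> simp }, fun c x => ?_⟩
  have h : ∀ i, σ (x i) * algebraMap E L (c i) * x i =
      algebraMap E L (c i * (e (x i)).1 ^ 2 + -δ * c i * (e (x i)).2 ^ 2) := fun i => by
    rw [mul_right_comm, he, ← map_mul]
    congr 1
    ring
  simp [hermL, diagQ, h, Finset.sum_add_distrib]

theorem qFunEquiv_trace (he : ∀ x, σ x * x = algebraMap E L ((e x).1 ^ 2 - δ * (e x).2 ^ 2))
    {c : ι → E} {q : (ι → L) → E} (hq : ∀ x, algebraMap E L (q x) = hermL E L σ c x x) :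
    QFunEquiv E q (diagQ E (Sum.elim c fun i => -δ * c i)) := by
  obtain ⟨g, hg⟩ := exists_linearEquiv_trace (ι := ι) he
  exact ⟨g, fun x => (algebraMap E L).injective (by rw [← hg, hq])⟩

theorem exists_trace (he : ∀ x, σ x * x = algebraMap E L ((e x).1 ^ 2 - δ * (e x).2 ^ 2))
    (c : ι → E) : ∃ q : (ι → L) → E, ∀ x, algebraMap E L (q x) = hermL E L σ c x x := by
  obtain ⟨g, hg⟩ := exists_linearEquiv_trace (ι := ι) he
  exact ⟨_, fun x => (hg c x).symm⟩

theorem quadCls_traceCoeffs_congr (h2 : (2 : E) ≠ 0)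
    (he : ∀ x, σ x * x = algebraMap E L ((e x).1 ^ 2 - δ * (e x).2 ^ 2)) {S T : Multiset E}
    (h : hermCls E L σ S = hermCls E L σ T) :
    quadCls E (traceCoeffs δ S) = quadCls E (traceCoeffs δ T) := by
  rw [← coeffs_ofCoeffs S, ← coeffs_ofCoeffs T, hermCls_coeffs_eq_iff] at h
  obtain ⟨g, hg⟩ := h.exists_linearEquiv
  obtain ⟨q, hq⟩ := exists_trace he (ofCoeffs S)
  obtain ⟨q', hq'⟩ := exists_trace he (ofCoeffs T)
  have := (qFunEquiv_trace he hq).symm.trans (QFunEquiv.trans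
    ⟨g.restrictScalars E, fun x => (algebraMap E L).injective ?_⟩ (qFunEquiv_trace he hq'))
  · rwa [← quadCls_eq_iff h2, coeffs_sumElim_trace, coeffs_sumElim_trace, coeffs_ofCoeffs,
      coeffs_ofCoeffs] at this
  · rw [hq, hq']
    exact hg x x

theorem quadCls_traceCoeffs_hyperbolic (h2 : (2 : E) ≠ 0) (hδ : δ ≠ 0) :
    quadCls E (traceCoeffs δ {1, -1}) = 2 • quadCls E {1, -1} := by
  have h : traceCoeffs δ ({1, -1} : Multiset E) = {1, -1} + {-δ, -(-δ)} := by
    simp [traceCoeffs]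
  rw [h, quadCls_add, two_nsmul]
  exact congrArg _ (hermCls_pair_neg h2 (neg_ne_zero.2 hδ))

theorem hyperbolic_of_trace_hyperbolic (h2 : (2 : E) ≠ 0) (hδ : δ ≠ 0) (hσ : ∀ x, σ (σ x) = x)
    (he : ∀ x, σ x * x = algebraMap E L ((e x).1 ^ 2 - δ * (e x).2 ^ 2)) :
    ∀ (n : ℕ) (S : Multiset E), S.card = n → 0 ∉ S → ∀ k m : ℕ,
      quadCls E (traceCoeffs δ S) + k • quadCls E {1, -1} = m • quadCls E {1, -1} →
      ∃ k m : ℕ, hermCls E L σ S + k • hermCls E L σ {1, -1} = m • hermCls E L σ {1, -1} := by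
  intro n
  induction n using Nat.strong_induction_on with
  | _ n ih =>
    intro S hn hS k m h
    rcases Nat.eq_zero_or_pos n with rfl | hpos
    · exact ⟨0, 0, by rw [Multiset.card_eq_zero.1 hn, hermCls_zero]; simp⟩
    obtain ⟨g, hg⟩ := exists_linearEquiv_trace (ι := Fin S.card) he
    have hc : ∀ i, ofCoeffs S i ≠ 0 := fun i h0 =>
      hS (by rw [← coeffs_ofCoeffs S]; exact mem_coeffs.2 ⟨i, h0⟩)
    obtain ⟨y, hy0, hy⟩ := (isMetabolic_of_cls h2 (k := k) (m := m)
      (c := Sum.elim (ofCoeffs S) fun i => -δ * ofCoeffs S i) (by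
        rw [coeffs_sumElim_trace, coeffs_ofCoeffs, h])).exists_ne_zero (by simp [hn, hpos])
    obtain ⟨T, hT0, hTc, hT⟩ := exists_hermCls_eq_hyperbolic_add h2 hσ (fun x => ⟨_, (he x).symm⟩)
      (ofCoeffs S) hc (g.symm y) (by simpa using hy0) (by
        rw [hg, g.apply_symm_apply, hy, map_zero])
    rw [coeffs_ofCoeffs, ← hermCls_add] at hT
    have h3 := quadCls_traceCoeffs_congr h2 he hT
    rw [traceCoeffs_add, quadCls_add, quadCls_traceCoeffs_hyperbolic h2 hδ] at h3
    obtain ⟨k', m', h'⟩ := ih T.card (by omega) T rfl hT0 (k + 2) m (by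
      rw [← h, h3, add_smul]
      abel)
    refine ⟨k', m' + 1, ?_⟩
    rw [hT, hermCls_add, add_assoc, h', succ_nsmul, add_comm]

theorem trace_hyperbolic_iff (h2 : (2 : E) ≠ 0) (hδ : δ ≠ 0) (hσ : ∀ x, σ (σ x) = x)
    (he : ∀ x, σ x * x = algebraMap E L ((e x).1 ^ 2 - δ * (e x).2 ^ 2))
    {S : Multiset E} (hS : 0 ∉ S) :
    (∃ k m : ℕ, quadCls E (traceCoeffs δ S) + k • quadCls E {1, -1} = m • quadCls E {1, -1}) ↔
      ∃ k m : ℕ,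
        hermCls E L σ S + k • hermCls E L σ {1, -1} = m • hermCls E L σ {1, -1} := by
  constructor
  · rintro ⟨k, m, h⟩
    exact hyperbolic_of_trace_hyperbolic h2 hδ hσ he _ S rfl hS k m h
  · rintro ⟨k, m, h⟩
    have := quadCls_traceCoeffs_congr h2 he (S := S + k • {1, -1}) (T := m • {1, -1}) h
    rw [traceCoeffs_add, quadCls_add, traceCoeffs_nsmul, traceCoeffs_nsmul, quadCls_nsmul,
      quadCls_nsmul, quadCls_traceCoeffs_hyperbolic h2 hδ, smul_smul, smul_smul] at this
    exact ⟨_, _, this⟩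

theorem two_ne_zero_of_algebra (L : Type*) [Field L] [Algebra E L] (h2 : (2 : E) ≠ 0) :
    (2 : L) ≠ 0 := by
  simpa only [map_ofNat] using (map_ne_zero (algebraMap E L)).2 h2

theorem quadCls_map_pair (h2 : (2 : E) ≠ 0) {s : L} (hs : s ^ 2 = algebraMap E L δ) (hδ : δ ≠ 0)
    {a : E} (ha : a ≠ 0) :
    quadCls L (({a, -δ * a} : Multiset E).map (algebraMap E L)) = quadCls L {1, -1} := by
  have ha' : algebraMap E L a ≠ 0 := (map_ne_zero _).2 ha
  have hδ' : algebraMap E L δ ≠ 0 := (map_ne_zero _).2 hδ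
  have h : quadCls L {algebraMap E L (-δ * a)} = quadCls L {-algebraMap E L a} :=
    hermCls_mul_norm (x := s) ((map_ne_zero _).2 (mul_ne_zero (neg_ne_zero.2 hδ) ha)) (by
      simp [← hs]
      ring)
  refine Eq.trans ?_ (hermCls_pair_neg (two_ne_zero_of_algebra L h2) ha')
  change quadCls L {algebraMap E L a} + quadCls L {algebraMap E L (-δ * a)} = _
  rw [h]
  rfl

theorem quadCls_map_traceCoeffs (h2 : (2 : E) ≠ 0) {s : L} (hs : s ^ 2 = algebraMap E L δ)
    (hδ : δ ≠ 0) {T : Multiset E} (hT : 0 ∉ T) :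
    quadCls L ((traceCoeffs δ T).map (algebraMap E L)) = T.card • quadCls L {1, -1} := by
  induction T using Multiset.induction_on with
  | empty => simp [traceCoeffs_zero, quadCls_zero]
  | cons a T ih =>
    simp only [Multiset.mem_cons, not_or] at hT
    rw [← Multiset.singleton_add, traceCoeffs_add, Multiset.map_add, quadCls_add, ih hT.2,
      traceCoeffs_singleton, quadCls_map_pair h2 hs hδ (Ne.symm hT.1), Multiset.card_add,
      Multiset.card_singleton, add_nsmul, one_nsmul]

theorem map_hyperbolic : ({1, -1} : Multiset E).map (algebraMap E L) = {1, -1} := by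
  simp

theorem exists_traceCoeffs_of_isotropic (h2 : (2 : E) ≠ 0) (hδ : δ ≠ 0) {n : ℕ} {c : Fin n → E}
    (hc : ∀ i, c i ≠ 0) {x y : Fin n → E} (hxy : x ≠ 0 ∨ y ≠ 0)
    (h : diagQ E c x + δ * diagQ E c y = 0) (h' : hermL E E AlgEquiv.refl c x y = 0) :
    ∃ T U : Multiset E, 0 ∉ T ∧ 0 ∉ U ∧ T.card + 2 = n ∧ ∃ k : ℕ, U.card + k = 1 ∧
      quadCls E (coeffs c) = quadCls E T + quadCls E (traceCoeffs δ U) + k • quadCls E {1, -1} := by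
  by_cases hy : diagQ E c y = 0
  · have hx : diagQ E c x = 0 := by simpa [hy] using h
    obtain ⟨z, hz, hz0⟩ : ∃ z ≠ 0, diagQ E c z = 0 := by
      rcases hxy with hxy | hxy
      exacts [⟨x, hxy, hx⟩, ⟨y, hxy, hy⟩]
    obtain ⟨T, hT0, hTc, hT⟩ := exists_hermCls_eq_hyperbolic_add (σ := AlgEquiv.refl) h2
      (fun _ => rfl) (fun x => ⟨x * x, rfl⟩) c hc z hz (by rw [hermL_refl_self, hz0])
    refine ⟨T, 0, hT0, by simp, hTc, 1, rfl, ?_⟩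
    rw [traceCoeffs_zero, quadCls_zero, add_zero, one_nsmul, add_comm]
    exact hT
  · have hx : diagQ E c x = -δ * diagQ E c y := by linear_combination h
    have hx0 : diagQ E c x ≠ 0 := by
      rw [hx]
      exact mul_ne_zero (neg_ne_zero.2 hδ) hy
    have hyx : hermL E E AlgEquiv.refl c y x = 0 := by
      rw [← h']
      simp only [hermL, AlgEquiv.coe_refl, id]
      exact Finset.sum_congr rfl fun i _ => by ring
    obtain ⟨T, hT0, hTc, hT⟩ := exists_quadCls_eq_pair_add h2 hc hy hx0 hyx
    refine ⟨T, {diagQ E c y}, hT0, by simpa using Ne.symm hy, by simpa using hTc, 0, by simp, ?_⟩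
    rw [hT, traceCoeffs_singleton, hx, zero_nsmul, add_zero, add_comm]

theorem exists_traceCoeffs_of_map_hyperbolic (h2 : (2 : E) ≠ 0) {s : L}
    (hs : s ^ 2 = algebraMap E L δ) (hδ : δ ≠ 0)
    (he : ∀ p, e.symm p = algebraMap E L p.1 + algebraMap E L p.2 * s) :
    ∀ (n : ℕ) (S : Multiset E), S.card = n → 0 ∉ S → ∀ k m : ℕ,
      quadCls L (S.map (algebraMap E L)) + k • quadCls L {1, -1} = m • quadCls L {1, -1} →
      ∃ T : Multiset E, 0 ∉ T ∧ ∃ k m : ℕ,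
        quadCls E S + k • quadCls E {1, -1} =
          quadCls E (traceCoeffs δ T) + m • quadCls E {1, -1} := by
  intro n
  induction n using Nat.strong_induction_on with
  | _ n ih =>
    intro S hn hS k m h
    rcases Nat.eq_zero_or_pos n with rfl | hpos
    · exact ⟨0, by simp, 0, 0, by rw [Multiset.card_eq_zero.1 hn, traceCoeffs_zero]⟩
    have hc : ∀ i, ofCoeffs S i ≠ 0 := fun i h0 =>
      hS (by rw [← coeffs_ofCoeffs S]; exact mem_coeffs.2 ⟨i, h0⟩)
    have h2' := two_ne_zero_of_algebra L h2
    obtain ⟨z, hz0, hz⟩ := (isMetabolic_of_cls h2' (k := k) (m := m)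
      (c := fun i => algebraMap E L (ofCoeffs S i)) (by
        rw [← coeffs_map, coeffs_ofCoeffs, h])).exists_ne_zero (by simp [hn, hpos])
    have hzsum : algebraMap E L (diagQ E (ofCoeffs S) (fun i => (e (z i)).1) +
          δ * diagQ E (ofCoeffs S) (fun i => (e (z i)).2)) +
        algebraMap E L (2 * hermL E E AlgEquiv.refl (ofCoeffs S) (fun i => (e (z i)).1)
          fun i => (e (z i)).2) * s = 0 := by
      rw [← hz]
      simp only [diagQ, hermL, map_add, map_mul, map_sum, ← hs, Finset.mul_sum, Finset.sum_mul,
        ← Finset.sum_add_distrib]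
      refine Finset.sum_congr rfl fun i _ => ?_
      conv_rhs => rw [← e.symm_apply_apply (z i), he]
      simp only [map_ofNat, map_pow, AlgEquiv.coe_refl, id, Algebra.algebraMap_self, RingHom.id_apply]
      ring
    rw [← he (_, _), LinearEquiv.map_eq_zero_iff, Prod.mk_eq_zero] at hzsum
    obtain ⟨h3, h4⟩ := hzsum
    obtain ⟨T, U, hT0, hU0, hTc, j, hUj, hTU⟩ := exists_traceCoeffs_of_isotropic h2 hδ hc
      (x := fun i => (e (z i)).1) (y := fun i => (e (z i)).2) (by
        by_contra! h0
        refine hz0 ?_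
        ext i
        rw [← e.symm_apply_apply (z i), show e (z i) = 0 from Prod.ext (congrFun h0.1 i) (congrFun h0.2 i)]
        exact e.symm.map_zero) h3 ((mul_eq_zero.1 h4).resolve_left h2)
    rw [coeffs_ofCoeffs] at hTU
    have h5 := quadCls_map (algebraMap E L)
      (S := S) (T := T + traceCoeffs δ U + j • ({1, -1} : Multiset E)) hTU
    rw [Multiset.map_add, Multiset.map_add, Multiset.map_nsmul, map_hyperbolic, quadCls_add,
      quadCls_add, quadCls_nsmul, quadCls_map_traceCoeffs h2 hs hδ hU0, add_assoc, ← add_nsmul, hUj,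
      one_nsmul] at h5
    obtain ⟨T', hT'0, k', m', h'⟩ := ih T.card (by omega) T rfl hT0 (k + 1) m (by
      rw [← h, h5, succ_nsmul']
      abel)
    refine ⟨T' + U, by simp [hT'0, hU0], k', m' + j, ?_⟩
    rw [hTU, traceCoeffs_add, quadCls_add, add_nsmul]
    calc _ = (quadCls E T + k' • quadCls E {1, -1}) + (quadCls E (traceCoeffs δ U) +
          j • quadCls E {1, -1}) := by abel
      _ = _ := by rw [h']; abel

theorem map_hyperbolic_iff (h2 : (2 : E) ≠ 0) {s : L}
    (hs : s ^ 2 = algebraMap E L δ) (hδ : δ ≠ 0)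
    (he : ∀ p, e.symm p = algebraMap E L p.1 + algebraMap E L p.2 * s)
    {S : Multiset E} (hS : 0 ∉ S) :
    (∃ T : Multiset E, 0 ∉ T ∧ ∃ k m : ℕ, quadCls E S + k • quadCls E {1, -1} =
        quadCls E (traceCoeffs δ T) + m • quadCls E {1, -1}) ↔
      ∃ k m : ℕ, quadCls L (S.map (algebraMap E L)) + k • quadCls L {1, -1} =
        m • quadCls L {1, -1} := by
  constructor
  · rintro ⟨T, hT, k, m, h⟩
    have := quadCls_map (algebraMap E L) (S := S + k • ({1, -1} : Multiset E))
      (T := traceCoeffs δ T + m • ({1, -1} : Multiset E)) h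
    rw [Multiset.map_add, Multiset.map_add, Multiset.map_nsmul, Multiset.map_nsmul,
      map_hyperbolic, quadCls_add, quadCls_add, quadCls_nsmul, quadCls_nsmul,
      quadCls_map_traceCoeffs h2 hs hδ hT, ← add_nsmul] at this
    exact ⟨_, _, this⟩
  · rintro ⟨k, m, h⟩
    exact exists_traceCoeffs_of_map_hyperbolic h2 hs hδ he _ S rfl hS k m h

theorem exists_linearEquiv_prod {s : L}
    (hbasis : ∀ x : L, ∃! p : E × E, x = algebraMap E L p.1 + algebraMap E L p.2 * s) :
    ∃ e : L ≃ₗ[E] E × E, ∀ p, e.symm p = algebraMap E L p.1 + algebraMap E L p.2 * s := by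
  let f : E × E →ₗ[E] L :=
    { toFun := fun p => algebraMap E L p.1 + algebraMap E L p.2 * s
      map_add' := fun p p' => by
        simp only [Prod.fst_add, Prod.snd_add, map_add]
        ring
      map_smul' := fun a p => by
        rw [Prod.smul_fst, Prod.smul_snd, smul_eq_mul, smul_eq_mul, map_mul,
          map_mul, RingHom.id_apply, Algebra.smul_def]
        ring }
  have hf : Function.Bijective f := by
    refine Function.bijective_iff_existsUnique f |>.2 fun x => ?_
    obtain ⟨p, hp, hu⟩ := hbasis x
    exact ⟨p, hp.symm, fun p' hp' => hu p' hp'.symm⟩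
  exact ⟨(LinearEquiv.ofBijective f hf).symm, fun p => rfl⟩

theorem exists_trace_witt_iff (h2 : (2 : E) ≠ 0)
    (he : ∀ x, σ x * x = algebraMap E L ((e x).1 ^ 2 - δ * (e x).2 ^ 2)) (c : ι → E) :
    (∃ (n : ℕ) (lam : Fin n → E) (_ : ∀ i, lam i ≠ 0) (q : (Fin n → L) → E),
        (∀ x, algebraMap E L (q x) = hermL E L σ lam x x) ∧ WittEquivQ E (diagQ E c) q) ↔
      ∃ T : Multiset E, 0 ∉ T ∧ ∃ k m : ℕ, quadCls E (coeffs c) + k • quadCls E {1, -1} =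
        quadCls E (traceCoeffs δ T) + m • quadCls E {1, -1} := by
  constructor
  · rintro ⟨n, lam, hlam, q, hq, h⟩
    refine ⟨coeffs lam, fun h0 => ?_, ?_⟩
    · obtain ⟨i, hi⟩ := mem_coeffs.1 h0
      exact hlam i hi
    · have := (wittEquivQ_diagQ_iff h2).1 (h.congr (.refl _) (qFunEquiv_trace he hq))
      rwa [coeffs_sumElim_trace] at this
  · rintro ⟨T, hT, h⟩
    obtain ⟨q, hq⟩ := exists_trace he (ofCoeffs T)
    refine ⟨T.card, ofCoeffs T, fun i h0 => hT ?_, q, hq, ?_⟩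
    · rw [← coeffs_ofCoeffs T]
      exact mem_coeffs.2 ⟨i, h0⟩
    · refine ((wittEquivQ_diagQ_iff h2).2 ?_).congr (.refl _) (qFunEquiv_trace he hq).symm
      rwa [coeffs_sumElim_trace, coeffs_ofCoeffs]

theorem exists_diagQ_prod_witt_iff (h2 : (2 : E) ≠ 0) (c : ι → E) :
    (∃ (t : ℕ) (d : Fin t → E), (∀ j, d j ≠ 0) ∧ WittEquivQ E (diagQ E c)
        (diagQ E fun p : Fin t × Fin 2 => d p.1 * (if p.2 = 0 then 1 else -δ))) ↔
      ∃ T : Multiset E, 0 ∉ T ∧ ∃ k m : ℕ, quadCls E (coeffs c) + k • quadCls E {1, -1} =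
        quadCls E (traceCoeffs δ T) + m • quadCls E {1, -1} := by
  constructor
  · rintro ⟨t, d, hd, h⟩
    refine ⟨coeffs d, fun h0 => ?_, ?_⟩
    · obtain ⟨i, hi⟩ := mem_coeffs.1 h0
      exact hd i hi
    · rwa [wittEquivQ_diagQ_iff h2, coeffs_prod_trace] at h
  · rintro ⟨T, hT, h⟩
    refine ⟨T.card, ofCoeffs T, fun i h0 => hT ?_, ?_⟩
    · rw [← coeffs_ofCoeffs T]
      exact mem_coeffs.2 ⟨i, h0⟩
    · rwa [wittEquivQ_diagQ_iff h2, coeffs_prod_trace, coeffs_ofCoeffs]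

end Trace
/-- **Witt group of a quadratic extension with its unitary involution
(Scharlau, 10.1.2).**  Let `L = E(√δ)` be a quadratic field extension in
characteristic `≠ 2`, with nontrivial Galois automorphism `ι`.  The trace form
map `h ↦ q_h` (where `algebraMap E L (q_h x) = h(x,x)`) identifies the Witt group
`W(L, ι)` of hermitian forms over `(L, ι)` with the kernel of the base-change map
`W(E) → W(L)`; the image of `W(L, ι) → W(E)` is the principal ideal of `W(E)`
generated by the binary form `⟨1, −δ⟩`.  Moreover, for `a ∈ E*` the trace form of
the rank-1 hermitian form `⟨a⟩` is isomorphic to `a·⟨1, −δ⟩`.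
(Hermitian forms over `(L, ι)` are diagonalizable with coefficients in `E*`.) -/
theorem witt_group_of_quadratic_extension_unitary
    (E : Type*) [Field E] (hchar : (2 : E) ≠ 0)
    (L : Type*) [Field L] [Algebra E L]
    (δ : E) (hδ : ∀ c : E, c ^ 2 ≠ δ)
    (s : L) (hs : s ^ 2 = algebraMap E L δ)
    (σ : L ≃ₐ[E] L) (hσs : σ s = -s) (hσinv : ∀ x : L, σ (σ x) = x)
    (hbasis : ∀ x : L, ∃! p : E × E,
      x = algebraMap E L p.1 + algebraMap E L p.2 * s) :
    -- the trace map `W(L, ι) → W(E)` is injective :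
    (∀ (n : ℕ) (lam : Fin n → E), (∀ i, lam i ≠ 0) →
      ∀ qE : (Fin n → L) → E,
        (∀ x, algebraMap E L (qE x) = hermL E L σ lam x x) →
        (WittEquivQ E qE (diagQ E (hypDiag E 0)) ↔
          HermWittEquivL E L σ lam (Fin.elim0 : Fin 0 → E))) ∧
    -- its image is the kernel of base change `W(E) → W(L)`, which is the
    -- principal ideal of `W(E)` generated by `⟨1, −δ⟩` :
    (∀ (m : ℕ) (c : Fin m → E), (∀ i, c i ≠ 0) →
      ((∃ (n : ℕ) (lam : Fin n → E) (_ : ∀ i, lam i ≠ 0)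
          (qE : (Fin n → L) → E),
          (∀ x, algebraMap E L (qE x) = hermL E L σ lam x x) ∧
          WittEquivQ E (diagQ E c) qE) ↔
        WittEquivQ L (diagQ L fun i => algebraMap E L (c i))
          (diagQ L (hypDiag L 0))) ∧
      ((∃ (n : ℕ) (lam : Fin n → E) (_ : ∀ i, lam i ≠ 0)
          (qE : (Fin n → L) → E),
          (∀ x, algebraMap E L (qE x) = hermL E L σ lam x x) ∧
          WittEquivQ E (diagQ E c) qE) ↔
        (∃ (t : ℕ) (d : Fin t → E), (∀ j, d j ≠ 0) ∧
          WittEquivQ E (diagQ E c)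
            (diagQ E fun p : Fin t × Fin 2 =>
              d p.1 * (if p.2 = 0 then 1 else -δ))))) ∧
    -- the trace form of `⟨a⟩` is `a·⟨1, −δ⟩` :
    (∀ a : E, a ≠ 0 →
      ∃ g : L ≃ₗ[E] (Fin 2 → E), ∀ x : L,
        σ x * algebraMap E L a * x =
          algebraMap E L (a * ((g x 0) ^ 2 - δ * (g x 1) ^ 2))) := by
  obtain ⟨e, hsymm⟩ := exists_linearEquiv_prod hbasis
  have hδ0 : δ ≠ 0 := fun h => hδ 0 (by simp [h])
  have he : ∀ x, σ x * x = algebraMap E L ((e x).1 ^ 2 - δ * (e x).2 ^ 2) := fun x => by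
    have hx := hsymm (e x)
    rw [e.symm_apply_apply] at hx
    have hσx : σ x = algebraMap E L (e x).1 - algebraMap E L (e x).2 * s := by
      conv_lhs => rw [hx]
      simp [hσs, sub_eq_add_neg]
    rw [hσx, map_sub, map_mul, map_pow, map_pow, ← hs]
    linear_combination (algebraMap E L (e x).1 - algebraMap E L (e x).2 * s) * hx
  refine ⟨fun n lam hlam q hq => ?_, fun m c hc => ⟨?_, ?_⟩, fun a _ => ?_⟩
  · have h0 : 0 ∉ coeffs lam := fun h => (mem_coeffs.1 h).elim hlam
    have hq' := qFunEquiv_trace he hq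
    calc WittEquivQ E q (diagQ E (hypDiag E 0))
        ↔ WittEquivQ E (diagQ E (Sum.elim lam fun i => -δ * lam i)) (diagQ E (hypDiag E 0)) :=
          ⟨fun h => h.congr hq' (.refl _), fun h => h.congr hq'.symm (.refl _)⟩
      _ ↔ ∃ k m : ℕ, quadCls E (traceCoeffs δ (coeffs lam)) + k • quadCls E {1, -1} =
            m • quadCls E {1, -1} := by
          simp only [wittEquivQ_diagQ_iff hchar, coeffs_sumElim_trace, coeffs_hypDiag, zero_nsmul,
            quadCls_zero, zero_add]
      _ ↔ _ := trace_hyperbolic_iff hchar hδ0 hσinv he h0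
      _ ↔ _ := by
          simp only [hermWittEquivL_iff, coeffs_fin_zero, hermCls_zero, zero_add]
  · have h0 : 0 ∉ coeffs c := fun h => (mem_coeffs.1 h).elim hc
    rw [exists_trace_witt_iff hchar he, map_hyperbolic_iff hchar hs hδ0 hsymm h0,
      wittEquivQ_diagQ_iff (two_ne_zero_of_algebra L hchar)]
    simp only [coeffs_map, coeffs_hypDiag, zero_nsmul, quadCls_zero, zero_add]
  · rw [exists_trace_witt_iff hchar he, exists_diagQ_prod_witt_iff hchar]
  · refine ⟨e.trans (LinearEquiv.finTwoArrow E E).symm, fun x => ?_⟩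
    rw [mul_right_comm, he, ← map_mul, mul_comm]
    simp
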